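/- Let S¹ be the unit circle in the complex plane with the induced metric, f : S¹ → S¹ a homeomorphism and μ a Borel probability measure on S¹. If f is μ-expansive, then f has no periodic points. -/

import Mathlib

open MeasureTheory Set Filter

noncomputable instance : MeasurableSpace Circle := borel Circle
instance : BorelSpace Circle := ⟨rfl⟩

/-- `Γ_δ(x)` for a bijection `f`: points whose full orbit stays `δ`-close to that of `x`. -/
def Gamma {X : Type*} [MetricSpace X] (f : Equiv.Perm X) (δ : ℝ) (x : X) : Set X :=
  {y | ∀ n : ℤ, dist ((f ^ n) x) ((f ^ n) y) ≤ δ}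

/-- `f` is `μ`-expansive. -/
def MeasureExpansive {X : Type*} [MetricSpace X] [MeasurableSpace X]
    (μ : Measure X) (f : Equiv.Perm X) : Prop :=
  ∃ δ > (0 : ℝ), ∀ x : X, μ (Gamma f δ x) = 0

open Topology in
theorem Monotone.eventually_cofinite_abs_sub_le {u : ℤ → ℝ} (hu : Monotone u) {C : ℝ}
    (hC : ∀ k, |u k| ≤ C) {ε : ℝ} (hε : 0 < ε) :
    ∀ᶠ k in cofinite, |u (k + 1) - u (k - 1)| ≤ ε := by
  have key : ∀ (l : Filter ℤ) (c : ℝ), Tendsto u l (𝓝 c) → Tendsto (· + 1) l l →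
      Tendsto (· - 1) l l → ∀ᶠ k in l, |u (k + 1) - u (k - 1)| ≤ ε := by
    intro l c h h₁ h₂
    have h₃ := ((h.comp h₁).sub (h.comp h₂)).abs
    rw [sub_self, abs_zero] at h₃
    exact h₃.eventually_le_const hε
  rw [Int.cofinite_eq, eventually_sup]
  refine ⟨key _ _ (tendsto_atBot_ciInf hu ⟨-C, ?_⟩) ?_ ?_,
    key _ _ (tendsto_atTop_ciSup hu ⟨C, ?_⟩) ?_ ?_⟩
  · rintro _ ⟨k, rfl⟩
    exact (abs_le.1 (hC k)).1
  · exact tendsto_atBot_add_const_right _ _ tendsto_id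
  · exact tendsto_atBot_add_const_right _ (-1) tendsto_id
  · rintro _ ⟨k, rfl⟩
    exact (abs_le.1 (hC k)).2
  · exact tendsto_atTop_add_const_right _ _ tendsto_id
  · exact tendsto_atTop_add_const_right _ (-1) tendsto_id

theorem Homeomorph.continuous_toEquiv_zpow {X : Type*} [TopologicalSpace X] (f : X ≃ₜ X) (k : ℤ) :
    Continuous (f.toEquiv ^ k : Equiv.Perm X) := by
  have hpow : ∀ g : Equiv.Perm X, Continuous g → ∀ n : ℕ, Continuous (g ^ n : Equiv.Perm X) := by
    intro g hg n
    rw [Equiv.Perm.coe_pow]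
    exact hg.iterate n
  cases k with
  | ofNat n => exact hpow _ f.continuous n
  | negSucc n =>
    rw [zpow_negSucc, ← inv_pow]
    exact hpow _ f.symm.continuous _

theorem MeasureExpansive.pow {X : Type*} [MetricSpace X] [CompactSpace X] [MeasurableSpace X]
    {μ : Measure X} {f : Equiv.Perm X} (hf : MeasureExpansive μ f)
    (hc : ∀ k : ℤ, Continuous (f ^ k : Equiv.Perm X)) {N : ℕ} (hN : 0 < N) :
    MeasureExpansive μ (f ^ N) := by
  obtain ⟨δ, hδ, h⟩ := hf
  have huc : ∀ i : ℕ, ∃ η > 0, ∀ x y, dist x y < η →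
      dist ((f ^ (i : ℤ)) x) ((f ^ (i : ℤ)) y) < δ := fun i ↦ by
    obtain ⟨η, hη, H⟩ := Metric.uniformContinuous_iff.1
      (CompactSpace.uniformContinuous_of_continuous (hc i)) δ hδ
    exact ⟨η, hη, fun x y hxy ↦ H hxy⟩
  choose η hη H using huc
  obtain ⟨ε, hε, hε'⟩ : ∃ ε > 0, ∀ i ∈ Finset.range N, ε < η i := by
    have hne : (Finset.range N).Nonempty := ⟨0, Finset.mem_range.2 hN⟩
    refine ⟨(Finset.range N).inf' hne η / 2, ?_, fun i hi ↦ ?_⟩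
    · exact half_pos ((Finset.lt_inf'_iff _).2 fun i _ ↦ hη i)
    · have h₁ := Finset.inf'_le η hi
      have h₂ := hη i
      linarith
  refine ⟨ε, hε, fun x ↦ measure_mono_null (t := Gamma f δ x) (fun y hy n ↦ ?_) (h x)⟩
  have hN' : (0 : ℤ) < N := by exact_mod_cast hN
  obtain ⟨i, hi⟩ := Int.eq_ofNat_of_zero_le (Int.emod_nonneg n hN'.ne')
  have hiN : i ∈ Finset.range N := by
    have := Int.emod_lt_of_pos n hN'
    rw [Finset.mem_range]
    omega
  have hdecomp : f ^ n = f ^ (i : ℤ) * (f ^ N) ^ (n / N) := by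
    rw [← zpow_natCast f N, ← zpow_mul, ← zpow_add, ← hi, Int.emod_add_mul_ediv]
  rw [hdecomp, Equiv.Perm.mul_apply, Equiv.Perm.mul_apply]
  exact (H i _ _ ((hy _).trans_lt (hε' i hiN))).le

section Order

variable {X : Type*} [MetricSpace X] {g : Equiv.Perm X} {a : X → ℝ}

theorem zpow_le_zpow_of_coordinate_mono (hda : ∀ x y, dist x y ≤ |a x - a y|)
    (hmono : ∀ x y, a x ≤ a y → a (g x) ≤ a (g y)) {x y : X} (hxy : a x ≤ a y) (k : ℤ) :
    a ((g ^ k) x) ≤ a ((g ^ k) y) := by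
  have hinj : ∀ x y, a x = a y → x = y := fun x y h ↦
    dist_le_zero.1 <| (hda x y).trans (by rw [h, sub_self, abs_zero])
  have hinv : ∀ x y, a x ≤ a y → a (g⁻¹ x) ≤ a (g⁻¹ y) := by
    intro x y h
    by_contra! hlt
    have h₁ := hmono _ _ hlt.le
    rw [show g (g⁻¹ x) = x from g.apply_symm_apply x,
      show g (g⁻¹ y) = y from g.apply_symm_apply y] at h₁
    rw [hinj x y (h.antisymm h₁)] at hlt
    exact lt_irrefl _ hlt
  have hpow : ∀ p : Equiv.Perm X, (∀ x y, a x ≤ a y → a (p x) ≤ a (p y)) →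
      ∀ n : ℕ, a ((p ^ n) x) ≤ a ((p ^ n) y) := by
    intro p hp n
    induction n with
    | zero => simpa using hxy
    | succ n ih =>
      rw [pow_succ', Equiv.Perm.mul_apply, Equiv.Perm.mul_apply]
      exact hp _ _ ih
  cases k with
  | ofNat n => exact hpow _ hmono n
  | negSucc n =>
    rw [zpow_negSucc, ← inv_pow]
    exact hpow _ hinv _

open Topology in
theorem Gamma_mem_nhds_of_lt (hc : ∀ k : ℤ, Continuous (g ^ k : Equiv.Perm X))
    (hda : ∀ x y, dist x y ≤ |a x - a y|) {C : ℝ} (hC : ∀ x, |a x| ≤ C)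
    (hmono : ∀ x y, a x ≤ a y → a (g x) ≤ a (g y)) {x : X} (ha : ContinuousAt a x)
    (hx : a x < a (g x)) {δ : ℝ} (hδ : 0 < δ) : Gamma g δ x ∈ 𝓝 x := by
  have hz := fun {x y : X} (h : a x ≤ a y) (k : ℤ) ↦ zpow_le_zpow_of_coordinate_mono hda hmono h k
  have hx' : a (g⁻¹ x) < a x := by
    by_contra! h
    have h₁ := hmono _ _ h
    rw [show g (g⁻¹ x) = x from g.apply_symm_apply x] at h₁
    exact h₁.not_gt hx
  have hu : Monotone fun k : ℤ ↦ a ((g ^ k) x) := by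
    refine monotone_int_of_le_succ fun k ↦ ?_
    rw [zpow_add_one, Equiv.Perm.mul_apply]
    exact hz hx.le k
  have hfin := eventually_cofinite.1 (hu.eventually_cofinite_abs_sub_le (fun k ↦ hC _) hδ)
  have hnear : ∀ᶠ y in 𝓝 x, ∀ k ∈ {k : ℤ | ¬|a ((g ^ (k + 1)) x) - a ((g ^ (k - 1)) x)| ≤ δ},
      dist ((g ^ k) x) ((g ^ k) y) < δ := by
    rw [eventually_all_finite hfin]
    intro k _
    filter_upwards [(hc k).continuousAt.preimage_mem_nhds (Metric.ball_mem_nhds _ hδ)] with y hy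
    rw [dist_comm]
    exact hy
  filter_upwards [hnear, ha.eventually (Ioo_mem_nhds hx' hx)] with y hy hay k
  by_cases hk : |a ((g ^ (k + 1)) x) - a ((g ^ (k - 1)) x)| ≤ δ
  · have h₁ : a ((g ^ (k - 1)) x) ≤ a ((g ^ k) y) := by
      rw [zpow_sub_one, Equiv.Perm.mul_apply]
      exact hz hay.1.le k
    have h₂ : a ((g ^ k) y) ≤ a ((g ^ (k + 1)) x) := by
      rw [zpow_add_one, Equiv.Perm.mul_apply]
      exact hz hay.2.le k
    have h₃ : a ((g ^ (k - 1)) x) ≤ a ((g ^ k) x) := hu (by omega)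
    have h₄ : a ((g ^ k) x) ≤ a ((g ^ (k + 1)) x) := hu (by omega)
    have h₅ := (abs_le.1 hk).2
    refine (hda _ _).trans (abs_le.2 ⟨?_, ?_⟩) <;> linarith
  · exact (hy k hk).le

open Topology in
theorem not_measureExpansive_of_coordinate_mono [SecondCountableTopology X] [MeasurableSpace X]
    {μ : Measure X} (hμ : μ ≠ 0) (hc : ∀ k : ℤ, Continuous (g ^ k : Equiv.Perm X))
    (hda : ∀ x y, dist x y ≤ |a x - a y|) {C : ℝ} (hC : ∀ x, |a x| ≤ C)
    (hmono : ∀ x y, a x ≤ a y → a (g x) ≤ a (g y))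
    (ha : ∀ x, g x ≠ x → ContinuousAt a x) : ¬ MeasureExpansive μ g := by
  rintro ⟨δ, hδ, h⟩
  have hfixed : μ {x | g x = x} = 0 := by
    refine measure_null_of_locally_null _ fun x hx ↦ ⟨{x | g x = x} ∩ Metric.closedBall x δ,
      inter_mem self_mem_nhdsWithin (mem_nhdsWithin_of_mem_nhds (Metric.closedBall_mem_nhds x hδ)),
      measure_mono_null (t := Gamma g δ x) (fun y hy n ↦ ?_) (h x)⟩
    rw [Equiv.Perm.zpow_apply_eq_self_of_apply_eq_self hx,
      Equiv.Perm.zpow_apply_eq_self_of_apply_eq_self hy.1, dist_comm]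
    exact hy.2
  have hmoved : μ {x | g x ≠ x} = 0 := by
    refine measure_null_of_locally_null _ fun x hx ↦
      ⟨Gamma g δ x, mem_nhdsWithin_of_mem_nhds ?_, h x⟩
    have hne : a x ≠ a (g x) := fun he ↦ hx <| Eq.symm <| dist_le_zero.1 <|
      (hda x (g x)).trans (by rw [he, sub_self, abs_zero])
    rcases hne.lt_or_gt with hlt | hlt
    · exact Gamma_mem_nhds_of_lt hc hda hC hmono (ha x hx) hlt hδ
    · refine Gamma_mem_nhds_of_lt (a := fun x ↦ -a x) hc (fun x y ↦ ?_) (C := C) (fun x ↦ ?_)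
        (fun x y hxy ↦ ?_) (ha x hx).neg (neg_lt_neg hlt) hδ
      · rw [neg_sub_neg, abs_sub_comm]
        exact hda x y
      · rw [abs_neg]
        exact hC x
      · exact neg_le_neg (hmono _ _ (neg_le_neg_iff.1 hxy))
  refine hμ (Measure.measure_univ_eq_zero.1 ?_)
  rw [← union_compl_self {x | g x = x}]
  exact measure_union_null hfixed hmoved

end Order

theorem Circle.dist_exp_le (s t : ℝ) : dist (Circle.exp s) (Circle.exp t) ≤ |s - t| := by
  have h : (Circle.exp s : ℂ) - Circle.exp t =
      Circle.exp t * (Complex.exp (Complex.I * (s - t : ℝ)) - 1) := by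
    rw [Circle.coe_exp, Circle.coe_exp, mul_sub, mul_one, ← Complex.exp_add]
    congr 2
    push_cast
    ring
  change dist (Circle.exp s : ℂ) (Circle.exp t) ≤ _
  rw [dist_eq_norm, h, norm_mul, Circle.norm_coe, one_mul]
  exact Real.norm_exp_I_mul_ofReal_sub_one_le

/-- The angular coordinate in `(-π, π]` on the circle, normalised to take the value `π` at `p`. -/
noncomputable def angleFrom (p z : Circle) : ℝ :=
  Complex.arg ((Circle.exp Real.pi / p * z : Circle) : ℂ)

theorem exp_angleFrom (p z : Circle) :
    p / Circle.exp Real.pi * Circle.exp (angleFrom p z) = z := by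
  rw [angleFrom, Circle.exp_arg, ← mul_assoc, div_mul_div_cancel, div_self', one_mul]

theorem angleFrom_mem (p z : Circle) : angleFrom p z ∈ Ioc (-Real.pi) Real.pi :=
  Complex.arg_mem_Ioc _

theorem angleFrom_mul_exp (p : Circle) {t : ℝ} (ht : t ∈ Ioc (-Real.pi) Real.pi) :
    angleFrom p (p / Circle.exp Real.pi * Circle.exp t) = t := by
  rw [angleFrom, ← mul_assoc, div_mul_div_cancel, div_self', one_mul, Circle.arg_exp ht.1 ht.2]

theorem angleFrom_injective (p : Circle) : Function.Injective (angleFrom p) := fun z w h ↦ by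
  rw [← exp_angleFrom p z, h, exp_angleFrom]

theorem angleFrom_self (p : Circle) : angleFrom p p = Real.pi := by
  have h := angleFrom_mul_exp p (t := Real.pi) ⟨by linarith [Real.pi_pos], le_rfl⟩
  rwa [div_mul_cancel] at h

theorem angleFrom_mem_Ioo {p z : Circle} (hz : z ≠ p) :
    angleFrom p z ∈ Ioo (-Real.pi) Real.pi :=
  ⟨(angleFrom_mem p z).1, (angleFrom_mem p z).2.lt_of_ne fun h ↦
    hz (angleFrom_injective p (h.trans (angleFrom_self p).symm))⟩

theorem dist_le_abs_angleFrom_sub (p z w : Circle) :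
    dist z w ≤ |angleFrom p z - angleFrom p w| := by
  conv_lhs => rw [← exp_angleFrom p z, ← exp_angleFrom p w]
  change dist ((_ : Circle) : ℂ) ((_ : Circle) : ℂ) ≤ _
  rw [Circle.coe_mul, Circle.coe_mul, dist_eq_norm, ← mul_sub, norm_mul,
    Circle.norm_coe, one_mul, ← dist_eq_norm]
  exact Circle.dist_exp_le _ _

theorem continuousAt_angleFrom {p z : Circle} (hz : z ≠ p) : ContinuousAt (angleFrom p) z := by
  refine ContinuousAt.comp (f := fun z : Circle ↦ ((Circle.exp Real.pi / p * z : Circle) : ℂ))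
    (g := Complex.arg) (Complex.continuousAt_arg ?_) (by fun_prop)
  exact Complex.mem_slitPlane_iff_arg.2 ⟨(angleFrom_mem_Ioo hz).2.ne, Circle.coe_ne_zero _⟩

theorem angleFrom_sq_mono {h : Equiv.Perm Circle} (hc : Continuous h) {p : Circle} (hp : h p = p)
    {x y : Circle} (hxy : angleFrom p x ≤ angleFrom p y) :
    angleFrom p (h (h x)) ≤ angleFrom p (h (h y)) := by
  set φ : ℝ → Circle := fun t ↦ p / Circle.exp Real.pi * Circle.exp t
  have hφc : Continuous φ := by fun_prop
  have hne : ∀ {z}, z ≠ p → h z ≠ p := fun hz he ↦ hz (h.injective (he.trans hp.symm))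
  have hφne : ∀ t ∈ Ioo (-Real.pi) Real.pi, φ t ≠ p := fun t ht he ↦ by
    have h₁ := angleFrom_mul_exp p (Ioo_subset_Ioc_self ht)
    change angleFrom p (φ t) = t at h₁
    rw [he, angleFrom_self] at h₁
    exact ht.2.ne' h₁
  have hcont : ContinuousOn (fun t ↦ angleFrom p (h (φ t))) (Ioo (-Real.pi) Real.pi) := fun t ht ↦
    (ContinuousAt.comp (f := fun t ↦ h (φ t)) (g := angleFrom p)
      (continuousAt_angleFrom (hne (hφne t ht)))
      (hc.comp hφc).continuousAt).continuousWithinAt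
  have hinj : InjOn (fun t ↦ angleFrom p (h (φ t))) (Ioo (-Real.pi) Real.pi) :=
    fun s hs t ht hst ↦ by
      have h₁ : φ s = φ t := h.injective (angleFrom_injective p hst)
      rw [← angleFrom_mul_exp p (Ioo_subset_Ioc_self hs),
        ← angleFrom_mul_exp p (Ioo_subset_Ioc_self ht)]
      exact congrArg (angleFrom p) h₁
  rcases eq_or_ne y p with rfl | hy
  · rw [hp, hp, angleFrom_self]
    exact (angleFrom_mem _ _).2
  rcases eq_or_ne x p with rfl | hx
  · rw [angleFrom_self] at hxy
    exact absurd hxy (angleFrom_mem_Ioo hy).2.not_ge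
  have hφa : ∀ z, φ (angleFrom p z) = z := exp_angleFrom p
  rcases hcont.strictMonoOn_of_injOn_Ioo (by linarith [Real.pi_pos]) hinj with hm | hm
  · have hstep : ∀ {x y}, x ≠ p → y ≠ p → angleFrom p x ≤ angleFrom p y →
        angleFrom p (h x) ≤ angleFrom p (h y) := fun hx hy hxy ↦ by
      simpa only [hφa] using hm.monotoneOn (angleFrom_mem_Ioo hx) (angleFrom_mem_Ioo hy) hxy
    exact hstep (hne hx) (hne hy) (hstep hx hy hxy)
  · have hstep : ∀ {x y}, x ≠ p → y ≠ p → angleFrom p x ≤ angleFrom p y →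
        angleFrom p (h y) ≤ angleFrom p (h x) := fun hx hy hxy ↦ by
      simpa only [hφa] using hm.antitoneOn (angleFrom_mem_Ioo hx) (angleFrom_mem_Ioo hy) hxy
    exact hstep (hne hy) (hne hx) (hstep hx hy hxy)

theorem measureExpansive_circle_no_periodic_points (f : Circle ≃ₜ Circle)
    (μ : Measure Circle) [IsProbabilityMeasure μ]
    (hf : MeasureExpansive μ f.toEquiv) :
    ∀ x : Circle, ∀ n : ℕ, 0 < n → (⇑f)^[n] x ≠ x := by
  intro p n hn hp
  have hpn : (f.toEquiv ^ n) p = p := by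
    rw [Equiv.Perm.coe_pow]
    exact hp
  have hc := f.continuous_toEquiv_zpow
  have hcn : Continuous (f.toEquiv ^ n : Equiv.Perm Circle) := hc n
  refine not_measureExpansive_of_coordinate_mono (g := f.toEquiv ^ (n * 2)) (a := angleFrom p)
    (C := Real.pi) (IsProbabilityMeasure.ne_zero μ) (fun k ↦ ?_) (dist_le_abs_angleFrom_sub p)
    (fun z ↦ Complex.abs_arg_le_pi _) (fun x y hxy ↦ ?_) (fun x hx ↦ continuousAt_angleFrom ?_)
    (hf.pow hc (by omega))
  · rw [← zpow_natCast, ← zpow_mul]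
    exact hc _
  · simpa only [pow_mul, pow_two, Equiv.Perm.mul_apply] using angleFrom_sq_mono hcn hpn hxy
  · rintro rfl
    apply hx
    rw [pow_mul, pow_two, Equiv.Perm.mul_apply, hpn, hpn]
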